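/- arXiv:1502.04396 — 2 statements merged into one kernel-verified Lean document; each statement's English description precedes it below -/
import Mathlib

section
/- Let $N \ge 2$, $\alpha > 1$, nonnegative weights $\tilde\gamma_j$ with $\gamma_u = \prod_{j\in u}\tilde\gamma_j$, let $g^* \in \mathcal{Z}_N^d$, and let $1/\alpha < \lambda \le 1$. Then $$\frac{1}{\varphi(N)}\sum_{\ell\in\mathcal{Z}_N} \kappa_{N,d+1,\alpha\lambda,\gamma^{\lambda}}(\ell) \le 2\zeta(\alpha\lambda)\,\big(1 - N^{-\alpha\lambda}\big)\,\frac{1}{\varphi(N)} \sum_{\emptyset \ne u \subseteq \{1,\ldots,d\}} \gamma_u^{\lambda}\,(2\zeta(\alpha\lambda))^{|u|}.$$ -/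
open Finset
open scoped Classical

/-- The Riemann zeta function `ζ(x) = ∑_{h=1}^∞ h^{-x}` as a real sum. -/
noncomputable def zetaR (x : ℝ) : ℝ := ∑' n : ℕ, ((n : ℝ) + 1) ^ (-x)

/-- `Z_N = {k ∈ {1,…,N-1} : gcd(k,N) = 1}` (for `N ≥ 2` the element `0` is
automatically excluded since `gcd(0,N) = N ≠ 1`). -/
def ZN (N : ℕ) : Finset ℕ := (Finset.range N).filter (fun k => Nat.Coprime k N)

/-- `r_α(γ,h) = γ_{u(h)} ∏_{j ∈ u(h)} |h_j|^{-α}` with product weights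
`γ_u = ∏_{j∈u} γ̃_j`; coordinate `j : Fin d` corresponds to index `j+1`. -/
noncomputable def rpw {d : ℕ} (α : ℝ) (γ : ℕ → ℝ) (h : Fin d → ℤ) : ℝ :=
  ∏ j ∈ Finset.univ.filter (fun j : Fin d => h j ≠ 0), (γ ((j : ℕ) + 1) * |(h j : ℝ)| ^ (-α))

/-- The squared worst-case error
`e²(g) = ∑_{h ∈ ℤ^d \ {0}, h·g ≡ 0 (mod N)} r_α(γ,h)`. -/
noncomputable def err2 {d : ℕ} (N : ℕ) (α : ℝ) (γ : ℕ → ℝ) (g : Fin d → ℕ) : ℝ :=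
  ∑' h : Fin d → ℤ, if h ≠ 0 ∧ ((N : ℤ) ∣ ∑ j, h j * (g j : ℤ)) then rpw α γ h else 0

/-- `θ_{N,d+1,α,γ}(g) = ∑_{h ∈ ℤ^{d+1}, h_{d+1} ≠ 0, h·(g*,g) ≡ 0 (mod N)} r_α(γ,h)`. -/
noncomputable def theta {d : ℕ} (N : ℕ) (α : ℝ) (γ : ℕ → ℝ) (gs : Fin d → ℕ) (g : ℕ) : ℝ :=
  ∑' h : Fin (d + 1) → ℤ,
    if h (Fin.last d) ≠ 0 ∧ ((N : ℤ) ∣ ∑ j, h j * ((Fin.snoc gs g : Fin (d + 1) → ℕ) j : ℤ))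
    then rpw α γ h else 0

/-- `κ_{N,d+1,α,γ}(g) = ∑_{h_{d+1} ∈ ℤ, N ∤ h_{d+1}} ∑_{h ∈ ℤ^d, h·g* ≡ -h_{d+1} g (mod N)}
|h_{d+1}|^{-α} r_α(γ,h)`, encoded with `p = (h_{d+1}, h)`. -/
noncomputable def kappa {d : ℕ} (N : ℕ) (α : ℝ) (γ : ℕ → ℝ) (gs : Fin d → ℕ) (g : ℕ) : ℝ :=
  ∑' p : ℤ × (Fin d → ℤ),
    if ¬ ((N : ℤ) ∣ p.1) ∧ ((N : ℤ) ∣ (∑ j, p.2 j * (gs j : ℤ) + p.1 * (g : ℤ)))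
    then |(p.1 : ℝ)| ^ (-α) * rpw α γ p.2 else 0


lemma aux_hasSum_congr {ι : Type} {f g : ι → ℝ} {a b : ℝ} (h : HasSum f a)
    (hfg : ∀ x, g x = f x) (hab : b = a) : HasSum g b := by
  rw [hab, funext hfg]
  exact h

/-- the two-sided zeta sum -/
lemma aux_hasSum_w (β : ℝ) (hβ : 1 < β) :
    HasSum (fun k : ℤ => |(k : ℝ)| ^ (-β)) (2 * zetaR β) := by
  have hs : Summable (fun n : ℕ => ((n : ℝ) + 1) ^ (-β)) := by
    have h1 : Summable (fun n : ℕ => (n : ℝ) ^ (-β)) := Real.summable_nat_rpow.2 (by linarith)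
    have h2 := (summable_nat_add_iff 1).2 h1
    simpa using h2
  have hz : HasSum (fun n : ℕ => ((n : ℝ) + 1) ^ (-β)) (zetaR β) := hs.hasSum
  have h0 : HasSum (fun n : ℕ => |(((n : ℕ) : ℤ) : ℝ)| ^ (-β)) (zetaR β) := by
    rw [← hasSum_nat_add_iff' 1]
    have : (0 : ℝ) ^ (-β) = 0 := Real.zero_rpow (by linarith)
    simp only [Finset.range_one, Finset.sum_singleton]
    norm_num [this]
    refine aux_hasSum_congr hz (fun n => ?_) rfl
    rw [abs_of_nonneg (by positivity)]
  have h3 : HasSum (fun n : ℕ => |((-((n : ℤ) + 1) : ℤ) : ℝ)| ^ (-β)) (zetaR β) := by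
    refine aux_hasSum_congr hz (fun n => ?_) rfl
    push_cast
    rw [abs_neg, abs_of_nonneg (by positivity)]
  have := HasSum.of_nat_of_neg_add_one (f := fun k : ℤ => |(k : ℝ)| ^ (-β)) h0 h3
  rwa [← two_mul] at this

lemma aux_hasSum_notdvd (β : ℝ) (hβ : 1 < β) (M : ℕ) (hM : 0 < M) :
    HasSum (fun k : ℤ => if (M : ℤ) ∣ k then 0 else |(k : ℝ)| ^ (-β))
      (2 * zetaR β * (1 - (M : ℝ) ^ (-β))) := by
  have hw := aux_hasSum_w β hβ
  have hinj : Function.Injective (fun k : ℤ => (M : ℤ) * k) := by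
    intro a b h
    exact mul_left_cancel₀ (by exact_mod_cast hM.ne') h
  have h1 : HasSum (fun k : ℤ => if (M : ℤ) ∣ k then |(k : ℝ)| ^ (-β) else 0)
      ((M : ℝ) ^ (-β) * (2 * zetaR β)) := by
    rw [← hinj.hasSum_iff]
    · refine aux_hasSum_congr (hw.mul_left ((M : ℝ) ^ (-β))) (fun k => ?_) rfl
      simp only [Function.comp, dvd_mul_right, if_true]
      push_cast
      rw [abs_mul, Nat.abs_cast, Real.mul_rpow (by positivity) (abs_nonneg _)]
    · intro x hx
      rw [if_neg]
      rintro ⟨c, rfl⟩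
      exact hx ⟨c, rfl⟩
  have h2 := hw.sub h1
  refine aux_hasSum_congr h2 (fun k => ?_) (by ring)
  split_ifs <;> simp

/-- number of solutions -/
noncomputable def auxCount (N : ℕ) (c k : ℤ) : ℕ :=
  ((ZN N).filter (fun l : ℕ => (N : ℤ) ∣ c + k * (l : ℤ))).card

lemma aux_gcd (N : ℕ) (c k : ℤ) (l : ℕ) (hl : l ∈ ZN N) (h : (N : ℤ) ∣ c + k * (l : ℤ)) :
    Int.gcd k N = Int.gcd c N := by
  have hco : Nat.Coprime l N := (Finset.mem_filter.1 hl).2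
  have hco' : IsCoprime (l : ℤ) (N : ℤ) := Nat.isCoprime_iff_coprime.2 hco
  apply Nat.dvd_antisymm
  · apply Int.dvd_gcd
    · have h1 : ((Int.gcd k N : ℕ) : ℤ) ∣ c + k * (l : ℤ) := (Int.gcd_dvd_right _ _).trans h
      exact (dvd_add_left ((Int.gcd_dvd_left _ _).mul_right _)).1 h1
    · exact Int.gcd_dvd_right _ _
  · apply Int.dvd_gcd
    · have h1 : ((Int.gcd c N : ℕ) : ℤ) ∣ c + k * (l : ℤ) := (Int.gcd_dvd_right _ _).trans h
      have h2 := (dvd_add_right (Int.gcd_dvd_left c N)).1 h1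
      have h3 : IsCoprime ((Int.gcd c N : ℕ) : ℤ) (l : ℤ) :=
        (hco'.of_isCoprime_of_dvd_right (Int.gcd_dvd_right _ _)).symm
      exact h3.dvd_of_dvd_mul_right h2
    · exact Int.gcd_dvd_right _ _

lemma aux_count_le (N : ℕ) (hN : 2 ≤ N) (c k : ℤ) : auxCount N c k ≤ Int.gcd k N := by
  have hm : 0 < Int.gcd k N := Int.gcd_pos_of_ne_zero_right _ (by positivity)
  set m := Int.gcd k N with hmdef
  have hmN : m ∣ N := by
    have : ((m : ℕ) : ℤ) ∣ N := Int.gcd_dvd_right _ _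
    exact_mod_cast this
  obtain ⟨M, hM⟩ := hmN
  have hMpos : 0 < M := by
    rcases Nat.eq_zero_or_pos M with h | h
    · subst h; omega
    · exact h
  rw [auxCount, ← Finset.card_range m]
  apply Finset.card_le_card_of_injOn (fun l => l / M)
  · intro l hl
    simp only [Finset.coe_filter, Set.mem_ofPred_eq, ZN, Finset.mem_filter, Finset.mem_range] at hl
    simp only [Finset.coe_range, Set.mem_Iio]
    exact (Nat.div_lt_iff_lt_mul hMpos).2 (hM ▸ hl.1.1)
  · intro a ha b hb hab
    simp only [Finset.coe_filter, Set.mem_ofPred_eq] at ha hb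
    have h1 : (N : ℤ) ∣ k * ((a : ℤ) - b) := by
      have e : k * ((a : ℤ) - b) = (c + k * (a : ℤ)) - (c + k * (b : ℤ)) := by ring
      rw [e]
      exact dvd_sub ha.2 hb.2
    have h2 : (M : ℤ) ∣ (a : ℤ) - b := by
      obtain ⟨k', hk'⟩ : (m : ℤ) ∣ k := Int.gcd_dvd_left _ _
      have hmz : (m : ℤ) ≠ 0 := by exact_mod_cast hm.ne'
      have hco : IsCoprime (M : ℤ) k' := by
        rw [Int.isCoprime_iff_gcd_eq_one, Int.gcd_comm]
        have : m * Int.gcd k' M = m * 1 := by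
          rw [mul_one]
          nth_rewrite 2 [hmdef]
          rw [hM, hk']
          push_cast
          rw [Int.gcd_mul_left]
          simp
        exact Nat.eq_of_mul_eq_mul_left hm this
      rw [hM, hk'] at h1
      push_cast at h1
      rw [mul_assoc] at h1
      exact hco.dvd_of_dvd_mul_left (Int.dvd_of_mul_dvd_mul_left hmz h1)
    have h3 : a % M = b % M := by
      have : (b : ℤ) ≡ a [ZMOD M] := Int.modEq_iff_dvd.2 h2
      exact (Int.natCast_modEq_iff.1 this).symm
    have e1 := Nat.div_add_mod a M
    have e2 := Nat.div_add_mod b M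
    simp only at hab
    rw [hab, h3] at e1
    exact e1.symm.trans e2

/-- the inner summand -/
noncomputable def auxT (N : ℕ) (β : ℝ) (c k : ℤ) : ℝ :=
  if (N : ℤ) ∣ k then 0 else |(k : ℝ)| ^ (-β) * (auxCount N c k : ℝ)

lemma auxT_dvd (N : ℕ) (β : ℝ) (c k : ℤ) (hc : (N : ℤ) ∣ c) : auxT N β c k = 0 := by
  unfold auxT
  split_ifs with h
  · rfl
  · have : auxCount N c k = 0 := by
      rw [auxCount, Finset.card_eq_zero, Finset.filter_eq_empty_iff]
      intro l hl hd
      apply h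
      have h2 := (dvd_add_right hc).1 hd
      have hco : Nat.Coprime l N := (Finset.mem_filter.1 hl).2
      have hco' : IsCoprime (l : ℤ) (N : ℤ) := Nat.isCoprime_iff_coprime.2 hco
      exact hco'.symm.dvd_of_dvd_mul_right h2
    simp [this]

lemma auxT_nonneg (N : ℕ) (β : ℝ) (c k : ℤ) : 0 ≤ auxT N β c k := by
  unfold auxT
  split_ifs <;> positivity

lemma auxT_tsum_le (N : ℕ) (hN : 2 ≤ N) (β : ℝ) (hβ : 1 < β) (c : ℤ) (hc : ¬ (N : ℤ) ∣ c) :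
    ∑' k, auxT N β c k ≤ 2 * zetaR β * (1 - (N : ℝ) ^ (-β)) := by
  have hm : 0 < Int.gcd c N := Int.gcd_pos_of_ne_zero_right _ (by positivity)
  have hgc : ∀ k, auxT N β c k ≠ 0 → Int.gcd k N = Int.gcd c N := by
    intro k hk
    unfold auxT at hk
    split_ifs at hk with h
    · exact absurd rfl hk
    · have : auxCount N c k ≠ 0 := by
        intro h0
        simp [h0] at hk
      obtain ⟨l, hl⟩ := Finset.card_ne_zero.1 this
      rw [Finset.mem_filter] at hl
      exact aux_gcd N c k l hl.1 hl.2
  set m := Int.gcd c N with hmdef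
  obtain ⟨M, hM⟩ : m ∣ N := by
    have : ((m : ℕ) : ℤ) ∣ N := Int.gcd_dvd_right _ _
    exact_mod_cast this
  have hMpos : 0 < M := by
    rcases Nat.eq_zero_or_pos M with h | h
    · subst h; omega
    · exact h
  have hinj : Function.Injective (fun k : ℤ => (m : ℤ) * k) := by
    intro a b h
    exact mul_left_cancel₀ (by exact_mod_cast hm.ne') h
  have hsupp : Function.support (auxT N β c) ⊆ Set.range (fun k : ℤ => (m : ℤ) * k) := by
    intro k hk
    have h1 := hgc k hk
    have h2 : ((Int.gcd k N : ℕ) : ℤ) ∣ k := Int.gcd_dvd_left _ _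
    rw [h1] at h2
    obtain ⟨k', hk'⟩ := h2
    exact ⟨k', hk'.symm⟩
  rw [← hinj.tsum_eq hsupp]
  have hsum := aux_hasSum_notdvd β hβ M hMpos
  have hm1 : (1 : ℝ) ≤ m := by exact_mod_cast hm
  have hle : ∀ k' : ℤ, auxT N β c ((m : ℤ) * k') ≤
      if (M : ℤ) ∣ k' then 0 else |(k' : ℝ)| ^ (-β) := by
    intro k'
    by_cases h0 : auxT N β c ((m : ℤ) * k') = 0
    · rw [h0]
      split_ifs <;> positivity
    have hg := hgc _ h0
    have hnd : ¬ (N : ℤ) ∣ (m : ℤ) * k' := by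
      intro h
      exact h0 (by simp [auxT, h])
    have hnd' : ¬ (M : ℤ) ∣ k' := by
      intro h
      apply hnd
      rw [hM]
      push_cast
      exact mul_dvd_mul_left _ h
    rw [auxT, if_neg hnd, if_neg hnd']
    have hcnt : (auxCount N c ((m : ℤ) * k') : ℝ) ≤ m := by
      have := aux_count_le N hN c ((m : ℤ) * k')
      rw [hg] at this
      exact_mod_cast this
    push_cast
    rw [abs_mul, Nat.abs_cast, Real.mul_rpow (by positivity) (abs_nonneg _)]
    have hA : (0 : ℝ) ≤ |(k' : ℝ)| ^ (-β) := by positivity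
    have hB : (m : ℝ) ^ (-β) * m ≤ 1 := by
      have : (m : ℝ) ^ (-β) ≤ (m : ℝ) ^ (-1 : ℝ) :=
        Real.rpow_le_rpow_of_exponent_le hm1 (by linarith)
      rw [Real.rpow_neg_one] at this
      calc (m : ℝ) ^ (-β) * m ≤ (m : ℝ)⁻¹ * m := by gcongr
        _ = 1 := inv_mul_cancel₀ (by positivity)
    calc (m : ℝ) ^ (-β) * |(k' : ℝ)| ^ (-β) * (auxCount N c ((m : ℤ) * k') : ℝ)
        ≤ (m : ℝ) ^ (-β) * |(k' : ℝ)| ^ (-β) * m := by gcongr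
      _ = ((m : ℝ) ^ (-β) * m) * |(k' : ℝ)| ^ (-β) := by ring
      _ ≤ 1 * |(k' : ℝ)| ^ (-β) := by gcongr
      _ = _ := one_mul _
  have hsl : Summable (fun k' : ℤ => auxT N β c ((m : ℤ) * k')) :=
    Summable.of_nonneg_of_le (fun _ => auxT_nonneg _ _ _ _) hle hsum.summable
  refine (hsl.tsum_le_tsum hle hsum.summable).trans ?_
  rw [hsum.tsum_eq]
  have hz : 0 ≤ zetaR β := tsum_nonneg (fun n => by positivity)
  have hMN : (M : ℝ) ≤ N := by
    rw [hM]; push_cast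
    have : (0 : ℝ) ≤ M := by positivity
    nlinarith
  have : (N : ℝ) ^ (-β) ≤ (M : ℝ) ^ (-β) :=
    Real.rpow_le_rpow_of_nonpos (by exact_mod_cast hMpos) hMN (by linarith)
  gcongr

lemma aux_hasSum_pi : ∀ (d : ℕ) (f : Fin d → ℤ → ℝ) (a : Fin d → ℝ), (∀ j k, 0 ≤ f j k) →
    (∀ j, HasSum (f j) (a j)) → HasSum (fun h : Fin d → ℤ => ∏ j, f j (h j)) (∏ j, a j) := by
  intro d
  induction d with
  | zero =>
    intro f a _ _
    simpa using hasSum_unique (fun h : Fin 0 → ℤ => ∏ j, f j (h j))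
  | succ d ih =>
    intro f a hf ha
    have h1 := ih (fun j => f j.succ) (fun j => a j.succ) (fun j k => hf _ _) (fun j => ha _)
    have h3 : Summable (fun x : ℤ × (Fin d → ℤ) => f 0 x.1 * ∏ j : Fin d, f j.succ (x.2 j)) :=
      Summable.mul_of_nonneg (f := f 0) (g := fun h : Fin d → ℤ => ∏ j : Fin d, f j.succ (h j))
        (ha 0).summable h1.summable (fun k => hf 0 k)
        (fun h => Finset.prod_nonneg fun j _ => hf j.succ (h j))
    have h2 := (ha 0).mul h1 h3
    rw [Fin.prod_univ_succ, ← (Fin.consEquiv (fun _ : Fin (d + 1) => ℤ)).hasSum_iff]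
    refine aux_hasSum_congr h2 (fun p => ?_) rfl
    simp [Fin.prod_univ_succ]

lemma aux_rpw_eq {d : ℕ} (β : ℝ) (η : ℕ → ℝ) (h : Fin d → ℤ) :
    rpw β η h = ∏ j : Fin d,
      (if h j = 0 then 1 else η ((j : ℕ) + 1) * |(h j : ℝ)| ^ (-β)) := by
  unfold rpw
  rw [Finset.prod_filter]
  apply Finset.prod_congr rfl
  intro j _
  by_cases hj : h j = 0 <;> simp [hj]

lemma aux_rpw_nonneg {d : ℕ} (β : ℝ) (η : ℕ → ℝ) (hη : ∀ j, 0 ≤ η j) (h : Fin d → ℤ) :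
    0 ≤ rpw β η h :=
  Finset.prod_nonneg fun j _ => mul_nonneg (hη _) (by positivity)

lemma aux_hasSum_rpw (d : ℕ) (β : ℝ) (hβ : 1 < β) (η : ℕ → ℝ) (hη : ∀ j, 0 ≤ η j) :
    HasSum (fun h : Fin d → ℤ => rpw β η h)
      (∏ j : Fin d, (1 + η ((j : ℕ) + 1) * (2 * zetaR β))) := by
  simp_rw [aux_rpw_eq]
  apply aux_hasSum_pi d
    (fun j k => if k = 0 then 1 else η ((j : ℕ) + 1) * |(k : ℝ)| ^ (-β))
  · intro j k
    have := hη ((j : ℕ) + 1)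
    split_ifs <;> positivity
  · intro j
    have h1 := (aux_hasSum_w β hβ).mul_left (η ((j : ℕ) + 1))
    have h2 : HasSum (fun k : ℤ => if k = 0 then (1 : ℝ) else 0) 1 := hasSum_ite_eq 0 1
    refine aux_hasSum_congr (h2.add h1) (fun k => ?_) rfl
    by_cases hk : k = 0
    · subst hk
      have : (0 : ℝ) ^ (-β) = 0 := Real.zero_rpow (by linarith)
      simp [this]
    · simp [hk]

lemma aux_prod_expand (d : ℕ) (η : ℕ → ℝ) (z : ℝ) :
    ∏ j : Fin d, (1 + η ((j : ℕ) + 1) * z) =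
      1 + ∑ u ∈ (Finset.range d).powerset.filter (fun u => u ≠ ∅),
        (∏ j ∈ u, η (j + 1)) * z ^ u.card := by
  rw [Fin.prod_univ_eq_prod_range (fun j => 1 + η (j + 1) * z) d, Finset.prod_one_add,
    Finset.filter_ne', ← Finset.add_sum_erase _ _ (Finset.empty_mem_powerset (Finset.range d))]
  simp [Finset.prod_mul_distrib]

lemma aux_main (N : ℕ) (hN : 2 ≤ N) (β : ℝ) (hβ : 1 < β) (η : ℕ → ℝ) (hη : ∀ j, 0 ≤ η j)
    (d : ℕ) (gs : Fin d → ℕ) :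
    ∑ l ∈ ZN N, kappa N β η gs l ≤ 2 * zetaR β * (1 - (N : ℝ) ^ (-β)) *
      ∑ u ∈ (Finset.range d).powerset.filter (fun u => u ≠ ∅),
        (∏ j ∈ u, η (j + 1)) * (2 * zetaR β) ^ u.card := by
  set B := 2 * zetaR β * (1 - (N : ℝ) ^ (-β)) with hB
  have hr := aux_hasSum_rpw d β hβ η hη
  have hr0 := aux_rpw_nonneg (d := d) β η hη
  have hF : Summable (fun p : ℤ × (Fin d → ℤ) => |(p.1 : ℝ)| ^ (-β) * rpw β η p.2) :=
    (aux_hasSum_w β hβ).summable.mul_of_nonneg hr.summable (fun k => by positivity) hr0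
  have hs : ∀ l : ℕ, Summable (fun p : ℤ × (Fin d → ℤ) =>
      if ¬ ((N : ℤ) ∣ p.1) ∧ ((N : ℤ) ∣ (∑ j, p.2 j * (gs j : ℤ) + p.1 * (l : ℤ)))
      then |(p.1 : ℝ)| ^ (-β) * rpw β η p.2 else 0) := by
    intro l
    have hp : ∀ p : ℤ × (Fin d → ℤ), 0 ≤ |(p.1 : ℝ)| ^ (-β) * rpw β η p.2 :=
      fun p => mul_nonneg (by positivity) (hr0 _)
    refine Summable.of_nonneg_of_le (fun p => ?_) (fun p => ?_) hF
    · split_ifs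
      · exact hp p
      · exact le_rfl
    · split_ifs
      · exact le_rfl
      · exact hp p
  have hG : ∀ p : ℤ × (Fin d → ℤ), (∑ l ∈ ZN N,
      if ¬ ((N : ℤ) ∣ p.1) ∧ ((N : ℤ) ∣ (∑ j, p.2 j * (gs j : ℤ) + p.1 * (l : ℤ)))
      then |(p.1 : ℝ)| ^ (-β) * rpw β η p.2 else 0) =
      auxT N β (∑ j, p.2 j * (gs j : ℤ)) p.1 * rpw β η p.2 := by
    intro p
    unfold auxT auxCount
    by_cases h : (N : ℤ) ∣ p.1
    · simp [h]
    · simp only [h, not_false_eq_true, true_and, if_false]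
      rw [← Finset.sum_filter, Finset.sum_const, nsmul_eq_mul]
      ring
  have hsG : Summable (fun p : ℤ × (Fin d → ℤ) =>
      auxT N β (∑ j, p.2 j * (gs j : ℤ)) p.1 * rpw β η p.2) := by
    have := summable_sum (s := ZN N) (fun l _ => hs l)
    simpa only [hG] using this
  have e1 : ∑ l ∈ ZN N, kappa N β η gs l = ∑' p : ℤ × (Fin d → ℤ),
      auxT N β (∑ j, p.2 j * (gs j : ℤ)) p.1 * rpw β η p.2 := by
    unfold kappa
    rw [← Summable.tsum_finsetSum (fun l _ => hs l)]
    exact tsum_congr hG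
  have hsG' := hsG.prod_symm
  have e2 : ∑' p : ℤ × (Fin d → ℤ), auxT N β (∑ j, p.2 j * (gs j : ℤ)) p.1 * rpw β η p.2
      = ∑' h : Fin d → ℤ, (∑' k, auxT N β (∑ j, h j * (gs j : ℤ)) k) * rpw β η h := by
    rw [← (Equiv.prodComm (Fin d → ℤ) ℤ).tsum_eq]
    refine (hsG'.tsum_prod).trans ?_
    refine tsum_congr fun h => ?_
    exact tsum_mul_right (f := fun k => auxT N β (∑ j, h j * (gs j : ℤ)) k)
      (a := rpw β η h) (L := SummationFilter.unconditional ℤ)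
  have hsO : Summable (fun h : Fin d → ℤ =>
      (∑' k, auxT N β (∑ j, h j * (gs j : ℤ)) k) * rpw β η h) := by
    have := hsG'.prod
    refine this.congr fun h => ?_
    exact tsum_mul_right (f := fun k => auxT N β (∑ j, h j * (gs j : ℤ)) k)
      (a := rpw β η h) (L := SummationFilter.unconditional ℤ)
  have hr' : HasSum (fun h : Fin d → ℤ => B * (rpw β η h - if h = 0 then 1 else 0))
      (B * (∏ j : Fin d, (1 + η ((j : ℕ) + 1) * (2 * zetaR β)) - 1)) :=
    (hr.sub (hasSum_ite_eq 0 1)).mul_left B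
  have hB0 : 0 ≤ B := by
    have hz : 0 ≤ zetaR β := tsum_nonneg (fun n => by positivity)
    have : (N : ℝ) ^ (-β) ≤ 1 :=
      Real.rpow_le_one_of_one_le_of_nonpos (by exact_mod_cast (by omega : 1 ≤ N)) (by linarith)
    have : 0 ≤ 1 - (N : ℝ) ^ (-β) := by linarith
    positivity
  have hle : ∀ h : Fin d → ℤ, (∑' k, auxT N β (∑ j, h j * (gs j : ℤ)) k) * rpw β η h ≤
      B * (rpw β η h - if h = 0 then 1 else 0) := by
    intro h
    by_cases h0 : h = 0
    · subst h0
      have : rpw β η (0 : Fin d → ℤ) = 1 := by simp [rpw]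
      simp [this, auxT_dvd]
    · simp only [h0, if_false, sub_zero]
      apply mul_le_mul_of_nonneg_right _ (hr0 h)
      by_cases hc : (N : ℤ) ∣ ∑ j, h j * (gs j : ℤ)
      · simpa [auxT_dvd _ _ _ _ hc] using hB0
      · exact auxT_tsum_le N hN β hβ _ hc
  rw [e1, e2]
  refine (hsO.tsum_le_tsum hle hr'.summable).trans ?_
  rw [hr'.tsum_eq, aux_prod_expand, add_sub_cancel_left]

theorem mean_kappa_bound (N : ℕ) (hN : 2 ≤ N) (α : ℝ) (hα : 1 < α)
    (γ : ℕ → ℝ) (hγ : ∀ j, 0 ≤ γ j) (d : ℕ) (gs : Fin d → ℕ)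
    (hgs : ∀ j, gs j ∈ ZN N) (lam : ℝ) (hlam1 : 1 / α < lam) (hlam2 : lam ≤ 1) :
    (1 / (N.totient : ℝ)) * ∑ ℓ ∈ ZN N, kappa N (α * lam) (fun j => γ j ^ lam) gs ℓ
      ≤ 2 * zetaR (α * lam) * (1 - (N : ℝ) ^ (-(α * lam)))
        * ((1 / (N.totient : ℝ)) *
            ∑ u ∈ (Finset.range d).powerset.filter (fun u => u ≠ ∅),
              (∏ j ∈ u, γ (j + 1) ^ lam) * (2 * zetaR (α * lam)) ^ u.card) := by
  have hβ : 1 < α * lam := by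
    rw [div_lt_iff₀ (by linarith)] at hlam1
    linarith
  have h := aux_main N hN (α * lam) hβ (fun j => γ j ^ lam)
    (fun j => Real.rpow_nonneg (hγ j) _) d gs
  rw [mul_left_comm]
  exact mul_le_mul_of_nonneg_left h (by positivity)
end

section
/- Let $N \ge 2$, $\alpha > 1$, nonnegative weights $\tilde\gamma_j$ with $\gamma_u = \prod_{j\in u}\tilde\gamma_j$, let $g^* = (g_1^*,\ldots,g_d^*) \in \mathcal{Z}_N^d$, let $1/\alpha < \lambda \le 1$, and let $\mathcal{E}_{d+1} \subsetneq \mathcal{Z}_N$. Suppose the inductive bound $$\big(e^2(g_1^*,\ldots,g_d^*)\big)^{\lambda} \le \frac{1}{\varphi(N)} \sum_{u \subseteq \{1,\ldots,d\}} \gamma_u^{\lambda}\,(2\zeta(\alpha\lambda))^{|u|} \prod_{j\in u}\frac{\varphi(N)}{\varphi(N)-|\mathcal{E}_j|}$$ holds (for prescribed exclusion sets $\mathcal{E}_2,\ldots,\mathcal{E}_d \subsetneq \mathcal{Z}_N$). If $g_{d+1}^* \in \mathcal{Z}_N \setminus \mathcal{E}_{d+1}$ minimizes $e^2(g_1^*,\ldots,g_d^*,g)$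 over $g \in \mathcal{Z}_N \setminus \mathcal{E}_{d+1}$, then $$\big(e^2(g_1^*,\ldots,g_d^*,g_{d+1}^*)\big)^{\lambda} \le \frac{1}{\varphi(N)} \sum_{u \subseteq \{1,\ldots,d+1\}} \gamma_u^{\lambda}\,(2\zeta(\alpha\lambda))^{|u|} \prod_{j\in u}\frac{\varphi(N)}{\varphi(N)-|\mathcal{E}_j|},$$ where $\mathcal{E}_1 = \emptyset$ and the empty product equals $1$. -/
open Finset
open scoped Classical

/-- one-dimensional factor -/
noncomputable def zz (x : ℝ) (k : ℤ) : ENNReal := if k ≠ 0 then ENNReal.ofReal (|(k : ℝ)| ^ (-x)) else 0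

lemma rpw_nonneg {d : ℕ} (α : ℝ) (γ : ℕ → ℝ) (hγ : ∀ j, 0 ≤ γ j) (h : Fin d → ℤ) : 0 ≤ rpw α γ h := by
  unfold rpw
  exact Finset.prod_nonneg fun j _ => mul_nonneg (hγ _) (Real.rpow_nonneg (abs_nonneg _) _)

lemma rpw_snoc {d : ℕ} (α : ℝ) (γ : ℕ → ℝ) (h : Fin d → ℤ) (k : ℤ) :
    rpw α γ (Fin.snoc h k : Fin (d + 1) → ℤ)
      = rpw α γ h * (if k ≠ 0 then γ (d + 1) * |(k : ℝ)| ^ (-α) else 1) := by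
  unfold rpw
  rw [Finset.prod_filter, Finset.prod_filter, Fin.prod_univ_castSucc]
  simp [Fin.snoc_castSucc, Fin.snoc_last]

lemma rpw_pow {d : ℕ} (α lam : ℝ) (γ : ℕ → ℝ) (hγ : ∀ j, 0 ≤ γ j) (h : Fin d → ℤ) :
    rpw α γ h ^ lam = rpw (α * lam) (fun j => γ j ^ lam) h := by
  unfold rpw
  rw [← Real.finsetProd_rpow]
  · refine Finset.prod_congr rfl fun j _ => ?_
    rw [Real.mul_rpow (hγ _) (Real.rpow_nonneg (abs_nonneg _) _), ← Real.rpow_mul (abs_nonneg _)]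
    ring_nf
  · exact fun j _ => mul_nonneg (hγ _) (Real.rpow_nonneg (abs_nonneg _) _)

lemma zz_summ {x : ℝ} (hx : 1 < x) : Summable (fun n : ℕ => ((n : ℝ) + 1) ^ (-x)) := by
  have := (summable_nat_add_iff 1).2 (Real.summable_nat_rpow.2 (show -x < -1 by linarith))
  simpa using this

lemma zetaR_nonneg (x : ℝ) : 0 ≤ zetaR x :=
  tsum_nonneg fun n => Real.rpow_nonneg (by positivity) _

lemma tsum_zz {x : ℝ} (hx : 1 < x) : ∑' k : ℤ, zz x k = ENNReal.ofReal (2 * zetaR x) := by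
  have h1 : ENNReal.ofReal (zetaR x) = ∑' n : ℕ, ENNReal.ofReal (((n : ℝ) + 1) ^ (-x)) :=
    ENNReal.ofReal_tsum_of_nonneg (fun n => Real.rpow_nonneg (by positivity) _) (zz_summ hx)
  rw [tsum_of_add_one_of_neg_add_one (f := zz x) ENNReal.summable ENNReal.summable]
  have e1 : ∀ n : ℕ, zz x ((n : ℤ) + 1) = ENNReal.ofReal (((n : ℝ) + 1) ^ (-x)) := by
    intro n
    have h : ((n : ℤ) + 1) ≠ 0 := by omega
    have h' : (0 : ℝ) ≤ (n : ℝ) + 1 := by positivity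
    simp [zz, h, abs_of_nonneg h']
  have e2 : ∀ n : ℕ, zz x (-((n : ℤ) + 1)) = ENNReal.ofReal (((n : ℝ) + 1) ^ (-x)) := by
    intro n
    have h : (-((n : ℤ) + 1)) ≠ 0 := by omega
    have h' : (0 : ℝ) ≤ (n : ℝ) + 1 := by positivity
    unfold zz
    rw [if_pos h]
    push_cast
    rw [abs_neg, abs_of_nonneg h']
  simp only [e1, e2, ← h1]
  have e0 : zz x 0 = 0 := by simp [zz]
  rw [e0, add_zero, two_mul, ENNReal.ofReal_add (zetaR_nonneg x) (zetaR_nonneg x)]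

lemma tsum_rpw {x : ℝ} (hx : 1 < x) (γ : ℕ → ℝ) (hγ : ∀ j, 0 ≤ γ j) (d : ℕ) :
    ∑' h : Fin d → ℤ, ENNReal.ofReal (rpw x γ h)
      = ENNReal.ofReal (∏ j ∈ Finset.range d, (1 + γ (j + 1) * (2 * zetaR x))) := by
  induction d with
  | zero => simp [tsum_fintype, rpw]
  | succ d ih =>
    rw [← (Fin.snocEquiv fun _ : Fin (d + 1) => ℤ).tsum_eq, ENNReal.tsum_prod', ENNReal.tsum_comm]
    have key : ∀ (h : Fin d → ℤ) (k : ℤ),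
        ENNReal.ofReal (rpw x γ (Fin.snocEquiv (fun _ : Fin (d + 1) => ℤ) (k, h)))
        = ENNReal.ofReal (rpw x γ h) * ((if k = 0 then 1 else 0) + ENNReal.ofReal (γ (d + 1)) * zz x k) := by
      intro h k
      have : (Fin.snocEquiv (fun _ : Fin (d + 1) => ℤ) (k, h)) = (Fin.snoc h k : Fin (d + 1) → ℤ) := rfl
      rw [this, rpw_snoc, ENNReal.ofReal_mul (rpw_nonneg _ _ hγ _)]
      congr 1
      by_cases hk : k = 0
      · simp [hk, zz]
      · simp [hk, zz, ENNReal.ofReal_mul (hγ _)]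
    simp only [key, ENNReal.tsum_mul_left, ENNReal.tsum_mul_right, ENNReal.tsum_add, tsum_ite_eq,
      tsum_zz hx, ih]
    have hz := zetaR_nonneg x
    rw [Finset.prod_range_succ, ENNReal.ofReal_mul (Finset.prod_nonneg fun j _ => by
      have := hγ (j+1); positivity), ENNReal.ofReal_add zero_le_one (by have := hγ (d+1); positivity),
      ENNReal.ofReal_mul (hγ _), ENNReal.ofReal_one]

lemma count_le (N : ℕ) (hN : 2 ≤ N) (s k : ℤ) :
    ((ZN N).filter (fun g : ℕ => (N : ℤ) ∣ s + k * g)).card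
      ≤ if (Int.gcd s N : ℤ) ∣ k then Int.gcd s N else 0 := by
  have hgcd : ∀ g ∈ (ZN N).filter (fun g : ℕ => (N : ℤ) ∣ s + k * g), Int.gcd k N = Int.gcd s N := by
    intro g hg
    simp only [ZN, Finset.mem_filter] at hg
    obtain ⟨⟨_, hc⟩, hd⟩ := hg
    have hc' : IsCoprime (g : ℤ) (N : ℤ) := Nat.isCoprime_iff_coprime.2 hc
    apply Nat.dvd_antisymm
    · apply Int.dvd_gcd _ (Int.gcd_dvd_right ..)
      have h1 : (Int.gcd k N : ℤ) ∣ s + k * g := (Int.gcd_dvd_right ..).trans hd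
      exact (Int.dvd_add_left ((Int.gcd_dvd_left ..).mul_right _)).1 h1
    · apply Int.dvd_gcd _ (Int.gcd_dvd_right ..)
      have h1 : (Int.gcd s N : ℤ) ∣ s + k * g := (Int.gcd_dvd_right ..).trans hd
      have h2 : (Int.gcd s N : ℤ) ∣ k * g := (Int.dvd_add_right (Int.gcd_dvd_left ..)).1 h1
      have h3 : IsCoprime (Int.gcd s N : ℤ) (g : ℤ) :=
        (hc'.of_isCoprime_of_dvd_right (Int.gcd_dvd_right ..)).symm
      exact h3.dvd_of_dvd_mul_right h2
  rcases Finset.eq_empty_or_nonempty ((ZN N).filter (fun g : ℕ => (N : ℤ) ∣ s + k * g)) with h0 | ⟨g0, hg0⟩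
  · rw [h0]; simp
  · have hm := hgcd g0 hg0
    rw [if_pos (by rw [← hm]; exact Int.gcd_dvd_left ..), ← hm]
    set m := Int.gcd k N with hmdef
    have hmN : m ∣ N := by
      have : (m : ℤ) ∣ (N : ℤ) := Int.gcd_dvd_right ..
      exact_mod_cast this
    obtain ⟨q, hq⟩ := hmN
    have hmpos : 0 < m := Nat.pos_of_ne_zero (by rintro h; rw [h] at hq; omega)
    have hqpos : 0 < q := Nat.pos_of_ne_zero (by rintro h; rw [h] at hq; omega)
    conv_rhs => rw [← Finset.card_range m]
    apply Finset.card_le_card_of_injOn (fun g => g / q)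
    · intro g hg
      simp only [ZN, Finset.coe_filter, Finset.mem_filter, Finset.mem_range, Set.mem_ofPred_eq] at hg
      simp only [Finset.coe_range, Set.mem_Iio]
      rw [Nat.div_lt_iff_lt_mul hqpos]
      omega
    · intro g hg g2 hg2 he
      simp only [ZN, Finset.coe_filter, Finset.mem_filter, Finset.mem_range, Set.mem_ofPred_eq] at hg hg2
      simp only at he
      have h1 : (N : ℤ) ∣ k * ((g : ℤ) - g2) := by
        have := dvd_sub hg.2 hg2.2
        have e : k * ((g : ℤ) - g2) = s + k * g - (s + k * g2) := by ring
        rwa [e]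
      have h2 : (q : ℤ) ∣ (g : ℤ) - g2 := by
        obtain ⟨k', hk'⟩ : (m : ℤ) ∣ k := Int.gcd_dvd_left ..
        have hm0 : (m : ℤ) ≠ 0 := by exact_mod_cast hmpos.ne'
        have hcop : IsCoprime (q : ℤ) k' := by
          rw [Int.isCoprime_iff_gcd_eq_one]
          have : m = m * Int.gcd q k' := by
            conv_lhs => rw [hmdef, hk', hq]
            push_cast
            rw [Int.gcd_mul_left, Int.gcd_comm]
            simp
          nlinarith [Nat.eq_of_mul_eq_mul_left hmpos (this.symm.trans (mul_one m).symm)]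
        rw [hq, hk', mul_assoc] at h1
        push_cast at h1
        exact hcop.dvd_of_dvd_mul_left (Int.dvd_of_mul_dvd_mul_left hm0 h1)
      have h3 : g2 % q = g % q := (Nat.modEq_iff_dvd).2 h2
      rw [← Nat.div_add_mod g q, ← Nat.div_add_mod g2 q, he, h3]

lemma tsum_count_le (N : ℕ) (hN : 2 ≤ N) {x : ℝ} (hx : 1 < x) (s : ℤ) :
    ∑' k : ℤ, zz x k * (((ZN N).filter (fun g : ℕ => (N : ℤ) ∣ s + k * g)).card : ENNReal)
      ≤ ∑' k : ℤ, zz x k := by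
  set m := Int.gcd s N with hm
  have hmpos : 0 < m := Int.gcd_pos_of_ne_zero_right _ (by omega)
  have hinj : Function.Injective (fun k : ℤ => (m : ℤ) * k) :=
    mul_right_injective₀ (by exact_mod_cast hmpos.ne')
  rw [← hinj.tsum_eq]
  · apply ENNReal.tsum_le_tsum
    intro k
    have hc := count_le N hN s (m * k)
    rw [← hm, if_pos (dvd_mul_right _ _)] at hc
    by_cases hk : k = 0
    · simp [hk, zz]
    have hmk : (m : ℤ) * k ≠ 0 := mul_ne_zero (by exact_mod_cast hmpos.ne') hk
    calc zz x (m * k) * _ ≤ zz x (m * k) * (m : ENNReal) := by gcongr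
      _ ≤ zz x k := by
        unfold zz
        rw [if_pos hk, if_pos hmk]
        have hm0 : (0:ℝ) < m := by exact_mod_cast hmpos
        rw [← ENNReal.ofReal_natCast m, ← ENNReal.ofReal_mul (Real.rpow_nonneg (abs_nonneg _) _)]
        apply ENNReal.ofReal_le_ofReal
        push_cast
        rw [abs_mul, abs_of_pos hm0, Real.mul_rpow hm0.le (abs_nonneg _)]
        have h1 : (m : ℝ) ^ (-x) * m ≤ 1 := by
          rw [← Real.rpow_add_one hm0.ne']
          exact Real.rpow_le_one_of_one_le_of_nonpos (by exact_mod_cast hmpos) (by linarith)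
        have h2 := Real.rpow_nonneg (abs_nonneg (k:ℝ)) (-x)
        nlinarith
  · intro k hk
    by_contra hne
    apply hk
    have hc := count_le N hN s k
    rw [← hm, if_neg] at hc
    · simp [Nat.le_zero.1 hc]
    · rintro ⟨c, rfl⟩; exact hne ⟨c, rfl⟩

lemma tsum_rpow_le {ι : Type*} (f : ι → ENNReal) {lam : ℝ} (h0 : 0 < lam) (h1 : lam ≤ 1) :
    (∑' i, f i) ^ lam ≤ ∑' i, f i ^ lam := by
  have hs : ∀ s : Finset ι, (∑ i ∈ s, f i) ^ lam ≤ ∑ i ∈ s, f i ^ lam := by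
    intro s
    induction s using Finset.induction_on with
    | empty => simp [h0]
    | insert a s ha ih =>
      rw [Finset.sum_insert ha, Finset.sum_insert ha]
      exact (ENNReal.rpow_add_le_add_rpow _ _ h0.le h1).trans (by gcongr)
  have ht := ((ENNReal.continuous_rpow_const (y := lam)).tendsto _).comp
    (ENNReal.summable (f := f)).hasSum
  exact le_of_tendsto' ht fun s => (hs s).trans (ENNReal.sum_le_tsum s)

/-- `ENNReal` version of `err2`. -/
noncomputable def eE {d : ℕ} (N : ℕ) (α : ℝ) (γ : ℕ → ℝ) (g : Fin d → ℕ) : ENNReal :=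
  ∑' h : Fin d → ℤ, if h ≠ 0 ∧ ((N : ℤ) ∣ ∑ j, h j * (g j : ℤ)) then ENNReal.ofReal (rpw α γ h) else 0

/-- `ENNReal` version of `theta`. -/
noncomputable def tE {d : ℕ} (N : ℕ) (α : ℝ) (γ : ℕ → ℝ) (gs : Fin d → ℕ) (g : ℕ) : ENNReal :=
  ∑' h : Fin d → ℤ, ∑' k : ℤ, if (N : ℤ) ∣ (∑ j, h j * (gs j : ℤ)) + k * g then
    ENNReal.ofReal (rpw α γ h) * (ENNReal.ofReal (γ (d + 1)) * zz α k) else 0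

lemma err2_eq {d : ℕ} (N : ℕ) (α : ℝ) (γ : ℕ → ℝ) (hγ : ∀ j, 0 ≤ γ j) (g : Fin d → ℕ) :
    err2 N α γ g = (eE N α γ g).toReal := by
  unfold err2 eE
  rw [ENNReal.tsum_toReal_eq]
  · congr 1; ext h
    split_ifs
    · rw [ENNReal.toReal_ofReal (rpw_nonneg _ _ hγ _)]
    · simp
  · intro h; split_ifs <;> simp

lemma eE_ne_top {d : ℕ} (N : ℕ) {α : ℝ} (hα : 1 < α) (γ : ℕ → ℝ) (hγ : ∀ j, 0 ≤ γ j) (g : Fin d → ℕ) :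
    eE N α γ g ≠ ⊤ := by
  have h : eE N α γ g ≤ ∑' h : Fin d → ℤ, ENNReal.ofReal (rpw α γ h) := by
    apply ENNReal.tsum_le_tsum
    intro h; split_ifs <;> simp
  rw [tsum_rpw hα γ hγ] at h
  exact ne_top_of_le_ne_top ENNReal.ofReal_ne_top h

lemma eE_snoc {d : ℕ} (N : ℕ) (α : ℝ) (γ : ℕ → ℝ) (hγ : ∀ j, 0 ≤ γ j) (gs : Fin d → ℕ) (g : ℕ) :
    eE N α γ (Fin.snoc gs g : Fin (d + 1) → ℕ) = eE N α γ gs + tE N α γ gs g := by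
  unfold eE tE
  rw [← (Fin.snocEquiv fun _ : Fin (d + 1) => ℤ).tsum_eq, ENNReal.tsum_prod', ENNReal.tsum_comm,
    ← ENNReal.tsum_add]
  congr 1; ext h
  rw [← tsum_ite_eq (0 : ℤ) (fun _ => if h ≠ 0 ∧ ((N : ℤ) ∣ ∑ j, h j * (gs j : ℤ)) then
    ENNReal.ofReal (rpw α γ h) else 0), ← ENNReal.tsum_add]
  congr 1; ext k
  have e : (Fin.snocEquiv (fun _ : Fin (d + 1) => ℤ) (k, h)) = (Fin.snoc h k : Fin (d + 1) → ℤ) := rfl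
  have e2 : (Fin.snoc h k : Fin (d + 1) → ℤ) = 0 ↔ h = 0 ∧ k = 0 := by
    constructor
    · intro H
      refine ⟨?_, ?_⟩
      · ext j; have := congrFun H (Fin.castSucc j); simpa using this
      · have := congrFun H (Fin.last d); simpa using this
    · rintro ⟨rfl, rfl⟩
      ext j
      refine Fin.lastCases ?_ (fun i => ?_) j <;> simp
  simp only [e, ne_eq, e2, Fin.sum_univ_castSucc, Fin.snoc_castSucc, Fin.snoc_last, rpw_snoc]
  by_cases hk : k = 0
  · subst hk; simp [zz]
  · simp [hk, zz, ENNReal.ofReal_mul, rpw_nonneg, hγ]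

lemma sum_tE_le {d : ℕ} (N : ℕ) (hN : 2 ≤ N) {α lam : ℝ} (hl0 : 0 < lam) (hl : lam ≤ 1)
    (hx : 1 < α * lam) (γ : ℕ → ℝ) (hγ : ∀ j, 0 ≤ γ j) (gs : Fin d → ℕ) :
    ∑ g ∈ ZN N, tE N α γ gs g ^ lam
      ≤ ENNReal.ofReal ((∏ j ∈ Finset.range d, (1 + γ (j + 1) ^ lam * (2 * zetaR (α * lam))))
          * (γ (d + 1) ^ lam * (2 * zetaR (α * lam)))) := by
  have hz := zetaR_nonneg (α * lam)
  have hγl : ∀ j, 0 ≤ γ j ^ lam := fun j => Real.rpow_nonneg (hγ j) _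
  have hzz : ∀ k, zz α k ^ lam = zz (α * lam) k := by
    intro k
    unfold zz
    split_ifs
    · rw [ENNReal.ofReal_rpow_of_nonneg (Real.rpow_nonneg (abs_nonneg _) _) hl0.le,
        ← Real.rpow_mul (abs_nonneg _)]
      ring_nf
    · simp [hl0]
  have step1 : ∀ g ∈ ZN N, tE N α γ gs g ^ lam ≤ ∑' h : Fin d → ℤ, ∑' k : ℤ,
      if (N : ℤ) ∣ (∑ j, h j * (gs j : ℤ)) + k * g then
      ENNReal.ofReal (rpw (α * lam) (fun j => γ j ^ lam) h) *
        (ENNReal.ofReal (γ (d + 1) ^ lam) * zz (α * lam) k) else 0 := by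
    intro g _
    refine (tsum_rpow_le _ hl0 hl).trans (ENNReal.tsum_le_tsum fun h => ?_)
    refine (tsum_rpow_le _ hl0 hl).trans (ENNReal.tsum_le_tsum fun k => ?_)
    split_ifs
    · rw [ENNReal.mul_rpow_of_nonneg _ _ hl0.le, ENNReal.mul_rpow_of_nonneg _ _ hl0.le, hzz,
        ENNReal.ofReal_rpow_of_nonneg (hγ _) hl0.le,
        ENNReal.ofReal_rpow_of_nonneg (rpw_nonneg _ _ hγ _) hl0.le, rpw_pow _ _ _ hγ]
    · simp [hl0]
  refine (Finset.sum_le_sum step1).trans ?_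
  rw [← Summable.tsum_finsetSum (fun _ _ => ENNReal.summable)]
  rw [ENNReal.ofReal_mul (Finset.prod_nonneg fun j _ => by have := hγl (j+1); positivity),
    ← tsum_rpw hx (fun j => γ j ^ lam) hγl, ← ENNReal.tsum_mul_right]
  refine ENNReal.tsum_le_tsum fun h => ?_
  rw [← Summable.tsum_finsetSum (fun _ _ => ENNReal.summable)]
  rw [ENNReal.ofReal_mul (hγl _), ← tsum_zz hx]
  calc _ = ENNReal.ofReal (rpw (α * lam) (fun j => γ j ^ lam) h) * (ENNReal.ofReal (γ (d + 1) ^ lam) *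
        ∑' k : ℤ, zz (α * lam) k *
        (((ZN N).filter (fun g : ℕ => (N : ℤ) ∣ (∑ j, h j * (gs j : ℤ)) + k * g)).card : ENNReal)) := by
        rw [← ENNReal.tsum_mul_left, ← ENNReal.tsum_mul_left]
        congr 1; ext k
        rw [← Finset.sum_filter, Finset.sum_const, nsmul_eq_mul]
        ring
    _ ≤ _ := mul_le_mul_right (mul_le_mul_right (tsum_count_le N hN hx _) _) _

lemma ZN_card (N : ℕ) : (ZN N).card = N.totient := by
  unfold ZN
  rw [Nat.totient]
  congr 1
  ext k
  simp [Nat.coprime_comm]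

theorem cbc_inductive_step (N : ℕ) (hN : 2 ≤ N) (α : ℝ) (hα : 1 < α)
    (γ : ℕ → ℝ) (hγ : ∀ j, 0 ≤ γ j) (d : ℕ) (gs : Fin d → ℕ)
    (hgs : ∀ j, gs j ∈ ZN N) (lam : ℝ) (hlam1 : 1 / α < lam) (hlam2 : lam ≤ 1)
    (E : ℕ → Finset ℕ) (hE1 : E 1 = ∅) (hE : ∀ j, 2 ≤ j → j ≤ d + 1 → E j ⊂ ZN N)
    (hind : err2 N α γ gs ^ lam
      ≤ (1 / (N.totient : ℝ)) * ∑ u ∈ (Finset.range d).powerset,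
          (∏ j ∈ u, γ (j + 1) ^ lam) * (2 * zetaR (α * lam)) ^ u.card
            * ∏ j ∈ u, (N.totient : ℝ) / ((N.totient : ℝ) - ((E (j + 1)).card : ℝ)))
    (g' : ℕ) (hg' : g' ∈ ZN N \ E (d + 1))
    (hmin : ∀ g ∈ ZN N \ E (d + 1),
      err2 N α γ (Fin.snoc gs g') ≤ err2 N α γ (Fin.snoc gs g)) :
    err2 N α γ (Fin.snoc gs g') ^ lam
      ≤ (1 / (N.totient : ℝ)) * ∑ u ∈ (Finset.range (d + 1)).powerset,
          (∏ j ∈ u, γ (j + 1) ^ lam) * (2 * zetaR (α * lam)) ^ u.card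
            * ∏ j ∈ u, (N.totient : ℝ) / ((N.totient : ℝ) - ((E (j + 1)).card : ℝ)) := by

  have hα0 : 0 < α := by linarith
  have hl0 : 0 < lam := lt_trans (by positivity) hlam1
  have hx : 1 < α * lam := by
    rw [div_lt_iff₀ hα0] at hlam1; linarith
  have hz := zetaR_nonneg (α * lam)
  have hγl : ∀ j, 0 ≤ γ j ^ lam := fun j => Real.rpow_nonneg (hγ j) _
  -- cardinalities
  have hφ : 0 < (N.totient : ℝ) := by exact_mod_cast Nat.totient_pos.2 (by omega)
  have hEc : ∀ j, j ≤ d → ((E (j + 1)).card : ℝ) < N.totient := by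
    intro j hj
    rcases Nat.eq_zero_or_pos j with rfl | hj0
    · simpa [hE1] using hφ
    · have := Finset.card_lt_card (hE (j + 1) (by omega) (by omega))
      rw [ZN_card] at this
      exact_mod_cast this
  have hEsub : E (d + 1) ⊆ ZN N := by
    rcases Nat.eq_zero_or_pos d with rfl | hd
    · simp [hE1]
    · exact (hE (d + 1) (by omega) le_rfl).1
  set a : ℕ → ℝ := fun j => γ (j + 1) ^ lam * (2 * zetaR (α * lam)) *
    ((N.totient : ℝ) / ((N.totient : ℝ) - ((E (j + 1)).card : ℝ))) with ha
  have hsum : ∀ n : ℕ, ∑ u ∈ (Finset.range n).powerset,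
          (∏ j ∈ u, γ (j + 1) ^ lam) * (2 * zetaR (α * lam)) ^ u.card
            * ∏ j ∈ u, (N.totient : ℝ) / ((N.totient : ℝ) - ((E (j + 1)).card : ℝ))
      = ∏ j ∈ Finset.range n, (1 + a j) := by
    intro n
    rw [Finset.prod_one_add]
    refine Finset.sum_congr rfl fun u _ => ?_
    rw [ha, Finset.prod_mul_distrib, Finset.prod_mul_distrib, Finset.prod_const]
  rw [hsum] at hind ⊢
  set S := ∏ j ∈ Finset.range d, (1 + γ (j + 1) ^ lam * (2 * zetaR (α * lam))) with hS
  set P := ∏ j ∈ Finset.range d, (1 + a j) with hP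
  have hSP : S ≤ P := by
    apply Finset.prod_le_prod
    · intro j _; have := hγl (j + 1); positivity
    · intro j hj
      have h1 := hEc j (Finset.mem_range.1 hj).le
      have h2 : 1 ≤ (N.totient : ℝ) / ((N.totient : ℝ) - ((E (j + 1)).card : ℝ)) := by
        rw [le_div_iff₀ (by linarith)]
        have : (0 : ℝ) ≤ (E (j + 1)).card := by positivity
        linarith
      have h3 : 0 ≤ γ (j + 1) ^ lam * (2 * zetaR (α * lam)) := by have := hγl (j + 1); positivity
      have := le_mul_of_one_le_right h3 h2
      simp only [ha]; linarith
  -- the averaging argument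
  have hfin := fun g => eE_ne_top N hα γ hγ (Fin.snoc gs g : Fin (d + 1) → ℕ)
  have hfin0 := eE_ne_top N hα γ hγ gs
  have htfin : ∀ g, tE N α γ gs g ≠ ⊤ := by
    intro g
    have := hfin g
    rw [eE_snoc N α γ hγ] at this
    exact (ENNReal.add_ne_top.1 this).2
  have hE2 : ∀ g, err2 N α γ (Fin.snoc gs g : Fin (d + 1) → ℕ)
      = err2 N α γ gs + (tE N α γ gs g).toReal := by
    intro g
    rw [err2_eq N α γ hγ, err2_eq N α γ hγ, eE_snoc N α γ hγ, ENNReal.toReal_add hfin0 (htfin g)]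
  have hmin2 : ∀ g ∈ ZN N \ E (d + 1), (tE N α γ gs g').toReal ≤ (tE N α γ gs g).toReal := by
    intro g hg
    have := hmin g hg
    rw [hE2, hE2] at this
    linarith
  have ht0 : 0 ≤ (tE N α γ gs g').toReal := ENNReal.toReal_nonneg
  have havg : ((N.totient : ℝ) - (E (d + 1)).card) * (tE N α γ gs g').toReal ^ lam
      ≤ S * (γ (d + 1) ^ lam * (2 * zetaR (α * lam))) := by
    have hcard : (((ZN N \ E (d + 1)).card : ℕ) : ℝ) = (N.totient : ℝ) - (E (d + 1)).card := by
      rw [Finset.card_sdiff_of_subset hEsub, Nat.cast_sub (Finset.card_le_card hEsub), ZN_card]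
    have h1 := sum_tE_le N hN hl0 hlam2 hx γ hγ gs
    have h2 := ENNReal.toReal_mono ENNReal.ofReal_ne_top h1
    have hS0 : 0 ≤ S := Finset.prod_nonneg fun j _ => by have := hγl (j + 1); positivity
    rw [ENNReal.toReal_ofReal (mul_nonneg hS0 (mul_nonneg (hγl _) (by positivity))),
      ENNReal.toReal_sum (fun g _ => ENNReal.rpow_ne_top_of_nonneg hl0.le (htfin g))] at h2
    refine le_trans ?_ h2
    rw [← hcard, ← nsmul_eq_mul, ← Finset.sum_const]
    calc _ ≤ ∑ g ∈ ZN N \ E (d + 1), (tE N α γ gs g ^ lam).toReal := by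
            refine Finset.sum_le_sum fun g hg => ?_
            rw [← ENNReal.toReal_rpow]
            exact Real.rpow_le_rpow ht0 (hmin2 g hg) hl0.le
      _ ≤ _ := Finset.sum_le_sum_of_subset_of_nonneg Finset.sdiff_subset
            (fun _ _ _ => ENNReal.toReal_nonneg)
  have hD : 0 < (N.totient : ℝ) - (E (d + 1)).card := by have := hEc d le_rfl; linarith
  have he0 : 0 ≤ err2 N α γ gs := by rw [err2_eq N α γ hγ]; exact ENNReal.toReal_nonneg
  rw [Finset.prod_range_succ, ← hP, hE2]
  have ht : (tE N α γ gs g').toReal ^ lam ≤ 1 / (N.totient : ℝ) * (P * a d) := by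
    have h3 : 0 ≤ γ (d + 1) ^ lam * (2 * zetaR (α * lam)) := by have := hγl (d + 1); positivity
    have e : 1 / (N.totient : ℝ) * (P * a d)
        = P * (γ (d + 1) ^ lam * (2 * zetaR (α * lam))) / ((N.totient : ℝ) - (E (d + 1)).card) := by
      simp only [ha]; field_simp
    rw [e, le_div_iff₀ hD, mul_comm]
    exact havg.trans (mul_le_mul_of_nonneg_right hSP h3)
  calc _ ≤ err2 N α γ gs ^ lam + (tE N α γ gs g').toReal ^ lam :=
        Real.rpow_add_le_add_rpow he0 ht0 hl0.le hlam2
    _ ≤ 1 / (N.totient : ℝ) * P + 1 / (N.totient : ℝ) * (P * a d) := add_le_add hind ht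
    _ = _ := by ring
end
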